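/- arXiv:1205.2908 — 3 statements merged into one kernel-verified Lean document; each statement's English description precedes it below -/
import Mathlib

section
/- Let d ≥ 1 and let x, y be points of the Euclidean space ℝ^d. Then the supremum of f(x) − f(y) over all real-valued continuous functions f on ℝ^d that vanish at infinity (f ∈ C₀(ℝ^d, ℝ)) and are Lipschitz with constant 1 equals the Euclidean distance between x and y: sSup { f(x) − f(y) : f ∈ C₀(ℝ^d, ℝ), LipschitzWith 1 f } = dist(x, y). (This is the content of the proposition that Connes' spectral distance between the pure states δ_x and δ_y of C₀(ℝ^d), computed with the Dirac operator of the flat Euclidean space, equals the Euclidean distance; the commutator norm condition ‖[∂̸,f]‖ ≤ 1 is equivalent to f being 1-Lipschitz.) -/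
/-- The tent function of height and radius `c` centred at `x`, which vanishes at infinity on a
proper metric space. -/
def tent {X : Type*} [MetricSpace X] [ProperSpace X] (x : X) (c : ℝ) :
    ZeroAtInftyContinuousMap X ℝ where
  toFun z := max (c - dist z x) 0
  continuous_toFun := by fun_prop
  zero_at_infty' := by
    refine tendsto_const_nhds.congr' ?_
    filter_upwards [(isCompact_closedBall x c).compl_mem_cocompact] with z hz
    simp only [Set.mem_compl_iff, Metric.mem_closedBall, not_le] at hz
    exact (max_eq_right (by linarith)).symm

theorem tent_apply {X : Type*} [MetricSpace X] [ProperSpace X] (x z : X) (c : ℝ) :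
    tent x c z = max (c - dist z x) 0 := rfl

theorem lipschitzWith_tent {X : Type*} [MetricSpace X] [ProperSpace X] (x : X) (c : ℝ) :
    LipschitzWith 1 (tent x c) := by
  refine LipschitzWith.of_le_add fun z w => ?_
  rw [tent_apply, tent_apply]
  have h := dist_triangle_left w x z
  have h' := le_max_left (c - dist w x) 0
  have h'' := le_max_right (c - dist w x) 0
  have h₀ := dist_nonneg (x := z) (y := w)
  exact max_le (by linarith) (by linarith)

/-- In a proper metric space, the `1`-Lipschitz functions vanishing at infinity recover the
distance, and the supremum is attained. -/
theorem isGreatest_sub_lipschitzWith_one {X : Type*} [MetricSpace X] [ProperSpace X] (x y : X) :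
    IsGreatest {r : ℝ | ∃ f : ZeroAtInftyContinuousMap X ℝ,
      LipschitzWith 1 f ∧ r = f x - f y} (dist x y) := by
  refine ⟨⟨tent x (dist x y), lipschitzWith_tent x _, ?_⟩, ?_⟩
  · simp [tent_apply, dist_comm y x]
  · rintro r ⟨f, hf, rfl⟩
    have h := hf.dist_le_mul x y
    rw [NNReal.coe_one, one_mul, Real.dist_eq] at h
    exact (le_abs_self _).trans h

/-- The spectral distance between the pure states `δ_x` and `δ_y` of `C₀(ℝ^d)`,
computed with the flat Euclidean Dirac operator (whose commutator norm condition
is equivalent to being 1-Lipschitz), equals the Euclidean distance. -/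
theorem spectral_distance_eq_euclidean_distance
    (d : ℕ) (hd : 1 ≤ d) (x y : EuclideanSpace ℝ (Fin d)) :
    sSup {r : ℝ | ∃ f : ZeroAtInftyContinuousMap (EuclideanSpace ℝ (Fin d)) ℝ,
        LipschitzWith 1 f ∧ r = f x - f y} = dist x y := by
  exact (isGreatest_sub_lipschitzWith_one x y).csSup_eq
end

section
/- Let λ > 0 and let i, j, k, l be natural numbers with |i − j| ≥ 2 and |k − l| ≥ 2. Set u = (e_i + e_j)/√2 and v = (e_k + e_l)/√2 in ℓ²(ℕ, ℂ). Then the quantum square-length between the superposition states ω_{ij} and ω_{kl} equals d_{L²}(ω_{ij}, ω_{kl}) = 2⟨u, H u⟩ + 2⟨v, H v⟩ − 4 Re(⟨u, a u⟩ · conj(⟨v, a v⟩)) = E_i + E_j + E_k + E_l = λ²(i + j + k + l + 2). -/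
/-- The normalized superposition `(e_i + e_j)/√2` in `ℓ²(ℕ, ℂ)`. -/
noncomputable def supVec2 (i j : ℕ) : ℕ → ℂ :=
  fun p => (((if p = i then 1 else 0) + (if p = j then 1 else 0)) : ℂ) /
    (Real.sqrt 2 : ℂ)

/-- Mean value `⟨u, H u⟩` of the harmonic oscillator Hamiltonian
`(H u)(n) = λ²(n + 1/2) u(n)`. -/
noncomputable def oscMean (lam : ℝ) (u : ℕ → ℂ) : ℝ :=
  ∑' n : ℕ, lam ^ 2 * ((n : ℝ) + 1 / 2) * ‖u n‖ ^ 2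

/-- Mean value `⟨u, a u⟩` of the annihilation operator `(a u)(n) = λ√(n+1) u(n+1)`. -/
noncomputable def annMean (lam : ℝ) (u : ℕ → ℂ) : ℂ :=
  ∑' n : ℕ, (starRingEnd ℂ) (u n) * ((lam : ℂ) * (Real.sqrt ((n : ℝ) + 1) : ℂ) * u (n + 1))

/-- The quantum square-length
`d_{L²}(ω_u, ω_v) = 2⟨u,Hu⟩ + 2⟨v,Hv⟩ − 4 Re(⟨u,au⟩ conj(⟨v,av⟩))`. -/
noncomputable def quantumSqLength (lam : ℝ) (u v : ℕ → ℂ) : ℝ :=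
  2 * oscMean lam u + 2 * oscMean lam v -
    4 * (annMean lam u * (starRingEnd ℂ) (annMean lam v)).re

theorem oscMean_supVec2 (lam : ℝ) {i j : ℕ} (hij : i ≠ j) :
    oscMean lam (supVec2 i j) = lam ^ 2 * ((i : ℝ) + j + 1) / 2 := by
  unfold oscMean
  rw [tsum_eq_sum (s := {i, j}), Finset.sum_pair hij]
  · simp [supVec2, hij, hij.symm]
    ring
  · intro n hn
    simp only [Finset.mem_insert, Finset.mem_singleton, not_or] at hn
    simp [supVec2, hn.1, hn.2]

theorem annMean_supVec2 (lam : ℝ) {i j : ℕ} (hij : 2 ≤ |(i : ℤ) - (j : ℤ)|) :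
    annMean lam (supVec2 i j) = 0 := by
  rw [le_abs] at hij
  have key (n : ℕ) : supVec2 i j n = 0 ∨ supVec2 i j (n + 1) = 0 := by
    by_cases h : n = i ∨ n = j
    · right
      have h₁ : n + 1 ≠ i ∧ n + 1 ≠ j := by omega
      simp [supVec2, h₁.1, h₁.2]
    · left
      rw [not_or] at h
      simp [supVec2, h.1, h.2]
  unfold annMean
  refine (tsum_congr fun n => ?_).trans tsum_zero
  rcases key n with h | h <;> simp [h]

/-- For indices with `|i−j| ≥ 2` and `|k−l| ≥ 2`, the quantum square-length between the
superposition states `ω_{ij}` and `ω_{kl}` is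
`E_i + E_j + E_k + E_l = λ²(i+j+k+l+2)`. -/
theorem quantumSqLength_superpositions
    (lam : ℝ) (hlam : 0 < lam) (i j k l : ℕ)
    (hij : 2 ≤ |(i : ℤ) - (j : ℤ)|) (hkl : 2 ≤ |(k : ℤ) - (l : ℤ)|) :
    quantumSqLength lam (supVec2 i j) (supVec2 k l) =
      lam ^ 2 * ((i : ℝ) + (j : ℝ) + (k : ℝ) + (l : ℝ) + 2) := by
  have hij' : i ≠ j := by rintro rfl; simp at hij
  have hkl' : k ≠ l := by rintro rfl; simp at hkl
  rw [quantumSqLength, oscMean_supVec2 lam hij', oscMean_supVec2 lam hkl',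
    annMean_supVec2 lam hij, zero_mul, Complex.zero_re]
  ring
end

section
/- Let λ > 0 and let i, j, k, l be natural numbers whose pairwise differences are at least 2 in absolute value. Set w = (e_i + e_j + e_k)/√3 in ℓ²(ℕ, ℂ). Then: (i) d_{L²}(ω_{ijk}, ω_l) = 2⟨w, H w⟩ + 2⟨e_l, H e_l⟩ − 4 Re(⟨w, a w⟩ · conj(⟨e_l, a e_l⟩)) = 2E_l + (2/3)(E_i + E_j + E_k); and (ii) d_{L²}(ω_{ijk}, ω_{ijk}) = 4⟨w, H w⟩ − 4 Re(⟨w, a w⟩ · conj(⟨w, a w⟩)) = (4/3)(E_i + E_j + E_k). -/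
/-- The normalized superposition `(e_i + e_j + e_k)/√3` in `ℓ²(ℕ, ℂ)`. -/
noncomputable def supVec3 (i j k : ℕ) : ℕ → ℂ :=
  fun p => (((if p = i then 1 else 0) + (if p = j then 1 else 0) +
      (if p = k then 1 else 0)) : ℂ) / (Real.sqrt 3 : ℂ)

/-- The standard basis vector `e_l` of `ℓ²(ℕ, ℂ)`. -/
noncomputable def basisVec (l : ℕ) : ℕ → ℂ :=
  fun p => if p = l then 1 else 0

/-- The eigenvalue `E_p = λ²(p + 1/2)` of the harmonic oscillator Hamiltonian. -/
noncomputable def En (lam : ℝ) (p : ℕ) : ℝ := lam ^ 2 * ((p : ℝ) + 1 / 2)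

/-- The annihilation operator has mean value zero on a vector whose support contains no two
consecutive indices. -/
theorem annMean_eq_zero (lam : ℝ) {u : ℕ → ℂ} (h : ∀ n, u n = 0 ∨ u (n + 1) = 0) :
    annMean lam u = 0 := by
  unfold annMean
  convert tsum_zero with n
  rcases h n with h | h <;> simp [h]

theorem annMean_supVec3 (lam : ℝ) {i j k : ℕ} (hij : 2 ≤ |(i : ℤ) - (j : ℤ)|)
    (hik : 2 ≤ |(i : ℤ) - (k : ℤ)|) (hjk : 2 ≤ |(j : ℤ) - (k : ℤ)|) :
    annMean lam (supVec3 i j k) = 0 := by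
  have supVec3_eq_zero {p : ℕ} (hi : p ≠ i) (hj : p ≠ j) (hk : p ≠ k) :
      supVec3 i j k p = 0 := by simp [supVec3, hi, hj, hk]
  refine annMean_eq_zero lam fun n => ?_
  by_cases h : n ≠ i ∧ n ≠ j ∧ n ≠ k
  · exact .inl (supVec3_eq_zero h.1 h.2.1 h.2.2)
  · exact .inr (supVec3_eq_zero (by grind) (by grind) (by grind))

theorem oscMean_basisVec (lam : ℝ) (l : ℕ) : oscMean lam (basisVec l) = En lam l := by
  unfold oscMean
  rw [tsum_eq_single l fun n hn => by simp [basisVec, hn]]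
  simp [basisVec, En]

theorem norm_sq_supVec3 {i j k : ℕ} (hij : i ≠ j) (hik : i ≠ k) (hjk : j ≠ k) (n : ℕ) :
    ‖supVec3 i j k n‖ ^ 2 =
      ((if n = i then 1 else 0) + (if n = j then 1 else 0) + (if n = k then 1 else 0)) / 3 := by
  have h3 : ‖(Real.sqrt 3 : ℂ)‖ ^ 2 = 3 := by simp
  rw [supVec3, norm_div, div_pow, h3]
  congr 1
  by_cases hi : n = i
  · subst hi; simp [hij, hik]
  · by_cases hj : n = j
    · subst hj; simp [hi, hjk]
    · by_cases hk : n = k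
      · subst hk; simp [hi, hj]
      · simp [hi, hj, hk]

theorem oscMean_supVec3 (lam : ℝ) {i j k : ℕ} (hij : i ≠ j) (hik : i ≠ k) (hjk : j ≠ k) :
    oscMean lam (supVec3 i j k) = (En lam i + En lam j + En lam k) / 3 := by
  have hasSum_En (m : ℕ) : HasSum (fun n => if n = m then En lam n else 0) (En lam m) := by
    simpa using hasSum_single (f := fun n => if n = m then En lam n else 0) m
      fun n hn => if_neg hn
  rw [oscMean, ← ((((hasSum_En i).add (hasSum_En j)).add (hasSum_En k)).div_const 3).tsum_eq]
  refine tsum_congr fun n => ?_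
  rw [norm_sq_supVec3 hij hik hjk, ← En, ← mul_div_assoc]
  simp only [mul_add, mul_ite, mul_one, mul_zero]

/-- For indices `i, j, k, l` with pairwise differences at least 2 in absolute value:
(i) `d_{L²}(ω_{ijk}, ω_l) = 2E_l + (2/3)(E_i + E_j + E_k)`;
(ii) `d_{L²}(ω_{ijk}, ω_{ijk}) = (4/3)(E_i + E_j + E_k)`. -/
theorem quantumSqLength_triple_superposition
    (lam : ℝ) (hlam : 0 < lam) (i j k l : ℕ)
    (hij : 2 ≤ |(i : ℤ) - (j : ℤ)|) (hik : 2 ≤ |(i : ℤ) - (k : ℤ)|)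
    (hil : 2 ≤ |(i : ℤ) - (l : ℤ)|) (hjk : 2 ≤ |(j : ℤ) - (k : ℤ)|)
    (hjl : 2 ≤ |(j : ℤ) - (l : ℤ)|) (hkl : 2 ≤ |(k : ℤ) - (l : ℤ)|) :
    quantumSqLength lam (supVec3 i j k) (basisVec l) =
        2 * En lam l + (2 / 3) * (En lam i + En lam j + En lam k) ∧
    quantumSqLength lam (supVec3 i j k) (supVec3 i j k) =
        (4 / 3) * (En lam i + En lam j + En lam k) := by
  have ne_of_gap {a b : ℕ} (h : 2 ≤ |(a : ℤ) - (b : ℤ)|) : a ≠ b := by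
    rintro rfl
    simp at h
  have hosc := oscMean_supVec3 lam (ne_of_gap hij) (ne_of_gap hik) (ne_of_gap hjk)
  simp only [quantumSqLength, annMean_supVec3 lam hij hik hjk, hosc, oscMean_basisVec, zero_mul,
    Complex.zero_re]
  constructor <;> ring
end
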